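/- Let 1 < α < 2, β₁ = 1/(α−1) and 1 < β₂ < 1/(α−1), and let (m_n) be a sequence of positive integers such that m_n^{−β₂}/n^{−β₁} → 0 as n → ∞. Then lim_{n→∞} ρ(n,−m_n)/(n^{−β₁/β₂} m_n^{1−β₂α}) = Σ_{i=0}^∞ ∫₀^∞ V(w_{(i,∞)} (1+i)^{−β₁}, s^{−β₂}) ds. -/

import Mathlib

open Filter MeasureTheory Real Set

/-- The kernel `V(x,y) = xy/(x^2+y^2)^{(2-α)/2}` with `V(0,0)=0`. -/
noncomputable def V (α : ℝ) : ℝ → ℝ → ℝ := fun x y =>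
  if x = 0 ∧ y = 0 then 0 else x * y / (x ^ 2 + y ^ 2) ^ ((2 - α) / 2)

lemma V_comm (α x y : ℝ) : V α x y = V α y x := by
  unfold V
  simp only [and_comm (a := x = 0), mul_comm x y, add_comm (x ^ 2)]

lemma V_le_aux (α : ℝ) (h1 : 1 < α) (h2 : α < 2) (x y : ℝ) :
    |V α x y| ≤ |x| * |y| ^ (α - 1) := by
  by_cases hy : y = 0
  · subst hy
    have : V α x 0 = 0 := by unfold V; simp
    rw [this]; simp; positivity
  have hy' : 0 < |y| := abs_pos.mpr hy
  unfold V
  rw [if_neg (by tauto), abs_div, abs_mul]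
  have hp : |y| ^ (2 - α) ≤ (x ^ 2 + y ^ 2) ^ ((2 - α) / 2) := by
    calc |y| ^ (2 - α) = (|y| ^ (2:ℝ)) ^ ((2 - α) / 2) := by
          rw [← rpow_mul hy'.le]; congr 1; ring
      _ ≤ _ := by
          apply rpow_le_rpow (by positivity) _ (by linarith)
          rw [rpow_two, sq_abs]; nlinarith [sq_nonneg x]
  have hp0 : 0 < |y| ^ (2 - α) := by positivity
  rw [abs_of_pos (hp0.trans_le hp), div_le_iff₀ (hp0.trans_le hp)]
  have : |y| = |y| ^ (α - 1) * |y| ^ (2 - α) := by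
    rw [← rpow_add hy']; ring_nf; simp
  calc |x| * |y| = |x| * |y| ^ (α - 1) * |y| ^ (2 - α) := by
        rw [mul_assoc, ← this]
    _ ≤ _ := by gcongr

lemma V_hom (α t x y : ℝ) (ht : 0 < t) : V α (t * x) (t * y) = t ^ α * V α x y := by
  unfold V
  by_cases h : x = 0 ∧ y = 0
  · simp [h.1, h.2]
  have h' : ¬ (t * x = 0 ∧ t * y = 0) := by simpa [ht.ne'] using h
  rw [if_neg h, if_neg h']
  have e : (t * x) ^ 2 + (t * y) ^ 2 = t ^ 2 * (x ^ 2 + y ^ 2) := by ring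
  have hq : 0 < x ^ 2 + y ^ 2 := by
    by_contra hh
    apply h
    constructor <;> nlinarith [sq_nonneg x, sq_nonneg y]
  rw [e, mul_rpow (by positivity) hq.le, ← rpow_two, ← rpow_mul ht.le,
    show (2:ℝ) * ((2 - α) / 2) = 2 - α by ring]
  have : t ^ α * t ^ (2 - α) = t ^ 2 := by
    rw [← rpow_add ht, ← rpow_two]; congr 1; ring
  have h1 : 0 < t ^ (2 - α) := by positivity
  have h3 : 0 < (x ^ 2 + y ^ 2) ^ ((2 - α) / 2) := by positivity
  field_simp
  linear_combination (-(x * y)) * this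

noncomputable def FF (α β : ℝ) (t : ℝ) : ℝ := min (t ^ (-β)) (t ^ (-β * (α - 1)))

lemma FF_int (α β : ℝ) (hα : 1 < α) (hβ : 1 < β) (hβ2 : β * (α - 1) < 1) :
    IntegrableOn (FF α β) (Ioi 0) := by
  have hmeas : Measurable (FF α β) := by unfold FF; fun_prop
  rw [← Ioc_union_Ioi_eq_Ioi (zero_le_one (α := ℝ))]
  apply IntegrableOn.union
  · have h := (intervalIntegral.intervalIntegrable_rpow' (a := 0) (b := 1) (r := -β * (α - 1)) (by linarith)).1
    refine Integrable.mono h hmeas.aestronglyMeasurable ?_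
    refine (ae_restrict_mem measurableSet_Ioc).mono fun t ht => ?_
    have := ht.1
    rw [norm_of_nonneg (by unfold FF; positivity), norm_of_nonneg (by positivity)]
    exact min_le_right _ _
  · have h := integrableOn_Ioi_rpow_of_lt (a := -β) (by linarith) (c := 1) one_pos
    refine Integrable.mono h hmeas.aestronglyMeasurable ?_
    refine (ae_restrict_mem measurableSet_Ioi).mono fun t ht => ?_
    have : 0 < t := one_pos.trans ht
    rw [norm_of_nonneg (by unfold FF; positivity), norm_of_nonneg (by positivity)]
    exact min_le_left _ _

lemma V_FF (α β : ℝ) (h1 : 1 < α) (h2 : α < 2) (K t x y : ℝ) (hK : 0 < K) (ht : 0 < t)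
    (hx : |x| ≤ K * t ^ (-β)) (hy : |y| ≤ K) : |V α x y| ≤ K ^ α * FF α β t := by
  unfold FF
  have hKe : K * K ^ (α - 1) = K ^ α := by
    rw [← rpow_one_add' hK.le (by linarith)]; congr 1; ring
  rw [mul_min_of_nonneg _ _ (by positivity)]
  apply le_min
  · calc _ ≤ |x| * |y| ^ (α - 1) := V_le_aux α h1 h2 x y
      _ ≤ (K * t ^ (-β)) * K ^ (α - 1) := by
        gcongr
      _ = _ := by rw [← hKe]; ring
  · rw [V_comm]
    calc _ ≤ |y| * |x| ^ (α - 1) := V_le_aux α h1 h2 y x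
      _ ≤ K * (K * t ^ (-β)) ^ (α - 1) := by
        gcongr
      _ = _ := by
        rw [mul_rpow hK.le (by positivity), ← rpow_mul ht.le, ← hKe]; ring

lemma step_int (h : ℕ → ℝ) (hint : IntegrableOn (fun s : ℝ => h ⌊s⌋₊) (Ioi 0)) :
    ∑' j, h j = ∫ s in Ioi (0 : ℝ), h ⌊s⌋₊ := by
  rw [← integral_Ici_eq_integral_Ioi]
  have hU : (⋃ j : ℕ, Ico (j : ℝ) (j + 1)) = Ici 0 := by
    ext s
    simp only [mem_iUnion, mem_Ico, mem_Ici]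
    constructor
    · rintro ⟨j, hj, _⟩; exact (Nat.cast_nonneg j).trans hj
    · intro hs; exact ⟨⌊s⌋₊, Nat.floor_le hs, Nat.lt_floor_add_one s⟩
  have hs := hasSum_integral_iUnion (μ := volume) (f := fun s : ℝ => h ⌊s⌋₊)
    (s := fun j : ℕ => Ico (j : ℝ) (j + 1)) (fun _ => measurableSet_Ico) ?_ ?_
  · rw [hU] at hs
    rw [← hs.tsum_eq]
    congr 1
    ext j
    rw [setIntegral_congr_fun (g := fun _ => h j) measurableSet_Ico]
    · simp
    · intro s hs
      have : ⌊s⌋₊ = j := by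
        rw [Nat.floor_eq_iff ((Nat.cast_nonneg j).trans hs.1)]; exact hs
      simp [this]
  · intro i j hij
    simp only [Function.onFun]
    rw [Set.disjoint_left]
    intro s hs hs'
    apply hij
    rw [← (Nat.floor_eq_iff ((Nat.cast_nonneg i).trans hs.1)).2 hs, ← (Nat.floor_eq_iff ((Nat.cast_nonneg j).trans hs'.1)).2 hs']
  · rw [hU, integrableOn_Ici_iff_integrableOn_Ioi]; exact hint

lemma step_int' (h : ℕ → ℝ) (L : ℝ) (hL : 0 < L)
    (hint : IntegrableOn (fun s : ℝ => h ⌊L * s⌋₊) (Ioi 0)) :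
    ∑' j, h j = L * ∫ s in Ioi (0 : ℝ), h ⌊L * s⌋₊ := by
  have h1 := (integrableOn_Ioi_comp_mul_left_iff (fun s : ℝ => h ⌊s⌋₊) 0 hL).1 hint
  rw [mul_zero] at h1
  rw [integral_comp_mul_left_Ioi (fun s : ℝ => h ⌊s⌋₊) 0 hL, step_int h h1, mul_zero, smul_eq_mul]
  field_simp

lemma w_bdd (w : ℕ → ℕ → ℝ) 
    (hA1 : Tendsto (fun p : ℕ × ℕ => w p.1 p.2) (atTop ×ˢ atTop) (nhds 1))
    (hA2 : ∀ i, ∃ l, Tendsto (fun j => w i j) atTop (nhds l))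
    (hA3 : ∀ j, ∃ l, Tendsto (fun i => w i j) atTop (nhds l)) :
    ∃ C, 0 < C ∧ ∀ i j, |w i j| ≤ C := by
  have h1 : ∀ᶠ p in (atTop ×ˢ atTop : Filter (ℕ × ℕ)), |w p.1 p.2| < 2 :=
    hA1.abs.eventually (gt_mem_nhds (by norm_num))
  rw [prod_atTop_atTop_eq, eventually_atTop] at h1
  obtain ⟨⟨N, M⟩, hN⟩ := h1
  have hb : ∀ i, ∃ B, ∀ j, |w i j| ≤ B := fun i => by
    obtain ⟨l, hl⟩ := hA2 i
    obtain ⟨B, hB⟩ := hl.abs.bddAbove_range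
    exact ⟨B, fun j => hB ⟨j, rfl⟩⟩
  have hb' : ∀ j, ∃ B, ∀ i, |w i j| ≤ B := fun i => by
    obtain ⟨l, hl⟩ := hA3 i
    obtain ⟨B, hB⟩ := hl.abs.bddAbove_range
    exact ⟨B, fun j => hB ⟨j, rfl⟩⟩
  choose B hB using hb
  choose B' hB' using hb'
  have hBn : ∀ i, 0 ≤ B i := fun i => (abs_nonneg _).trans (hB i 0)
  have hBn' : ∀ i, 0 ≤ B' i := fun i => (abs_nonneg _).trans (hB' i 0)
  have s1 : 0 ≤ ∑ i ∈ Finset.range N, B i := Finset.sum_nonneg fun i _ => hBn i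
  have s2 : 0 ≤ ∑ i ∈ Finset.range M, B' i := Finset.sum_nonneg fun i _ => hBn' i
  refine ⟨2 + ∑ i ∈ Finset.range N, B i + ∑ i ∈ Finset.range M, B' i, by positivity, fun i j => ?_⟩
  by_cases hi : i < N
  · have := Finset.single_le_sum (fun i _ => hBn i) (Finset.mem_range.2 hi)
    linarith [hB i j]
  by_cases hj : j < M
  · have := Finset.single_le_sum (fun i _ => hBn' i) (Finset.mem_range.2 hj)
    linarith [hB' j i]
  have := hN (i, j) ⟨not_lt.1 hi, not_lt.1 hj⟩
  simp only at this
  linarith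

lemma V_tendsto (α : ℝ) (f g : ℕ → ℝ) (x y : ℝ) (hx : 0 < x)
    (hf : Tendsto f atTop (nhds x)) (hg : Tendsto g atTop (nhds y)) :
    Tendsto (fun n => V α (f n) (g n)) atTop (nhds (V α x y)) := by
  have h1 : V α x y = x * y / (x ^ 2 + y ^ 2) ^ ((2 - α) / 2) := by
    unfold V; rw [if_neg (by rintro ⟨h, _⟩; exact hx.ne' h)]
  rw [h1]
  have hpos : 0 < x ^ 2 + y ^ 2 := by positivity
  have h2 : Tendsto (fun n => f n * g n / (f n ^ 2 + g n ^ 2) ^ ((2 - α) / 2)) atTop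
      (nhds (x * y / (x ^ 2 + y ^ 2) ^ ((2 - α) / 2))) := by
    refine (hf.mul hg).div ?_ (by positivity)
    exact ((hf.pow 2).add (hg.pow 2)).rpow_const (Or.inl hpos.ne')
  refine h2.congr' ?_
  filter_upwards [hf.eventually (lt_mem_nhds hx)] with n hn
  unfold V; rw [if_neg (by rintro ⟨h, _⟩; exact hn.ne' h)]

lemma L_pow (β₁ β₂ M N : ℝ) (hM : 0 < M) (hN : 0 < N) (hβ : 0 < β₂) :
    (M * N ^ (-(β₁ / β₂))) ^ (-β₂) = M ^ (-β₂) * N ^ β₁ := by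
  rw [mul_rpow hM.le (by positivity), ← rpow_mul hN.le]
  congr 2
  field_simp

lemma D_eq (α β₁ β₂ M N : ℝ) (hM : 0 < M) :
    N ^ (-(β₁ / β₂)) * M ^ (1 - β₂ * α) = (M * N ^ (-(β₁ / β₂))) * ((M ^ β₂) ^ α)⁻¹ := by
  rw [← rpow_mul hM.le, rpow_sub hM, rpow_one]
  ring

lemma x_eq (β₁ β₂ M N w I J : ℝ) (hM : 0 < M) (hN : 0 < N) (hI : 0 < I) (hJ : 0 < J)
    (hβ : 0 < β₂) :
    M ^ β₂ * (w * I ^ (-β₁) * J ^ (-β₂)) =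
      w * (I / N) ^ (-β₁) * (J / (M * N ^ (-(β₁ / β₂)))) ^ (-β₂) := by
  rw [div_rpow hI.le hN.le, div_rpow hJ.le (by positivity), L_pow β₁ β₂ M N hM hN hβ,
    rpow_neg hM.le, rpow_neg hN.le]
  have := rpow_pos_of_pos hM β₂
  have := rpow_pos_of_pos hN β₁
  field_simp

lemma y_eq (β₂ M w a J : ℝ) (hM : 0 < M) (hJ : 0 < J) :
    M ^ β₂ * (w * a * J ^ (-β₂)) = w * a * (J / M) ^ (-β₂) := by
  rw [div_rpow hJ.le hM.le, rpow_neg hM.le]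
  have := rpow_pos_of_pos hM β₂
  field_simp

lemma bsum (α β₁ β₂ C I : ℝ) (hα : 1 < α) (hC : 0 < C)
    (hβ₁ : β₁ = 1 / (α - 1)) (hβ₂l : 1 < β₂) :
    Summable (fun i : ℕ => (C * (1 + (i : ℝ)) ^ (-β₁)) ^ α *
      ((((1 + (i : ℝ)) ^ (-β₁)) ^ (1 / β₂))⁻¹ * I)) := by
  have hp : -β₁ * α + β₁ * (1 / β₂) < -1 := by
    have h0 : 0 < α - 1 := by linarith
    have e : β₁ * (α - 1) = 1 := by rw [hβ₁]; field_simp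
    have hb : 0 < β₁ := by rw [hβ₁]; positivity
    have : 1 / β₂ < 1 := by rw [div_lt_one (by linarith)]; exact hβ₂l
    nlinarith
  have h := (summable_nat_add_iff 1).2 (Real.summable_nat_rpow.2 hp)
  refine (h.mul_left (C ^ α * I)).congr fun i => ?_
  have hi : (0:ℝ) < 1 + i := by positivity
  rw [mul_rpow hC.le (by positivity), ← rpow_mul hi.le, ← rpow_mul hi.le, ← rpow_neg hi.le]
  push_cast
  rw [add_comm (i:ℝ) 1, rpow_add hi, show -(-β₁ * (1 / β₂)) = β₁ * (1 / β₂) by ring]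
  ring

theorem stmt17 (α β₁ β₂ : ℝ)
    (hα : 1 < α) (hα2 : α < 2)
    (hβ₁ : β₁ = 1 / (α - 1)) (hβ₂l : 1 < β₂) (hβ₂u : β₂ < 1 / (α - 1))
    (w : ℕ → ℕ → ℝ) (hw : ∀ i j, w i j ≠ 0)
    (hA1 : Tendsto (fun p : ℕ × ℕ => w p.1 p.2) (atTop ×ˢ atTop) (nhds 1))
    (winf : ℕ → ℝ)
    (hA2 : ∀ i, Tendsto (fun j => w i j) atTop (nhds (winf i)) ∧ 0 < winf i)
    (wco : ℕ → ℝ)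
    (hA3 : ∀ j, Tendsto (fun i => w i j) atTop (nhds (wco j)) ∧ 0 < wco j)
    (c : ℕ → ℕ → ℝ)
    (hc : ∀ i j, c i j = w i j * (1 + (i : ℝ)) ^ (-β₁) * (1 + (j : ℝ)) ^ (-β₂))
    (ρ : ℕ → ℕ → ℝ)
    (hsum : ∀ n m : ℕ, 1 ≤ n → 1 ≤ m →
      Summable (fun q : ℕ × ℕ => V α (c (q.1 + n) q.2) (c q.1 (q.2 + m))))
    (hρ : ∀ n m : ℕ, 1 ≤ n → 1 ≤ m →
      ρ n m = ∑' i : ℕ, ∑' j : ℕ, V α (c (i + n) j) (c i (j + m)))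
    (m : ℕ → ℕ) (hm : ∀ n, 1 ≤ m n)
    (hratio : Tendsto (fun n : ℕ => (m n : ℝ) ^ (-β₂) / (n : ℝ) ^ (-β₁))
      atTop (nhds 0))
    :
    Tendsto (fun n : ℕ => ρ n (m n) / ((n : ℝ) ^ (-(β₁ / β₂)) * (m n : ℝ) ^ (1 - β₂ * α)))
      atTop
      (nhds (∑' i : ℕ, ∫ s in Ioi (0 : ℝ), V α (winf i * (1 + (i : ℝ)) ^ (-β₁)) (s ^ (-β₂)))) := by
  have hβ0 : 0 < β₂ := by linarith
  have hα0 : 0 < α - 1 := by linarith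
  have hβ₁0 : 0 < β₁ := by rw [hβ₁]; positivity
  have hβα : β₂ * (α - 1) < 1 := by rwa [lt_div_iff₀ hα0] at hβ₂u
  obtain ⟨C, hC, hwC⟩ := w_bdd w hA1 (fun i => ⟨_, (hA2 i).1⟩) (fun j => ⟨_, (hA3 j).1⟩)
  have hFint := FF_int α β₂ hα hβ₂l hβα
  set a : ℕ → ℝ := fun i => (1 + (i : ℝ)) ^ (-β₁) with ha
  have ha0 : ∀ i, 0 < a i := fun i => by simp only [ha]; positivity
  set L : ℕ → ℝ := fun n => (m n : ℝ) * (n : ℝ) ^ (-(β₁ / β₂)) with hL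
  have hm0 : ∀ n, (0:ℝ) < m n := fun n => by exact_mod_cast hm n
  have hL0 : ∀ n : ℕ, 1 ≤ n → 0 < L n := fun n hn => by
    have : (0:ℝ) < n := by exact_mod_cast hn
    have := hm0 n
    simp only [hL]; positivity
  set T : ℕ → ℕ → ℕ → ℝ := fun n i j =>
    V α ((m n : ℝ) ^ β₂ * c (i + n) j) ((m n : ℝ) ^ β₂ * c i (j + m n)) with hT
  set b : ℕ → ℝ → ℝ := fun i s => (C * a i) ^ α * FF α β₂ (s * (a i) ^ (1 / β₂)) with hb
  have hbint : ∀ i, IntegrableOn (b i) (Ioi 0) := fun i => by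
    have : 0 < (a i) ^ (1 / β₂) := by have := ha0 i; positivity
    refine Integrable.const_mul ?_ _
    refine (integrableOn_Ioi_comp_mul_right_iff (FF α β₂) 0 this).2 ?_
    rwa [zero_mul]
  have hTb : ∀ n : ℕ, 1 ≤ n → ∀ i, ∀ s : ℝ, 0 < s → |T n i ⌊L n * s⌋₊| ≤ b i s := by
    intro n hn i s hs
    have hn0 : (0:ℝ) < n := by exact_mod_cast hn
    have hai := ha0 i
    have hLn := hL0 n hn
    have hmn := hm0 n
    simp only [hT, hb]
    apply V_FF α β₂ hα hα2 _ _ _ _ (by positivity) (by positivity)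
    · rw [hc, x_eq β₁ β₂ _ n _ _ _ (hm0 n) hn0 (by positivity) (by positivity) hβ0,
        abs_mul, abs_mul]
      have e : C * a i * (s * a i ^ (1 / β₂)) ^ (-β₂) = C * 1 * s ^ (-β₂) := by
        rw [mul_rpow hs.le (by positivity), ← rpow_mul hai.le,
          show 1 / β₂ * -β₂ = -1 by field_simp, rpow_neg_one]
        field_simp
      rw [e]
      gcongr
      · exact hwC _ _
      · rw [abs_of_nonneg (by positivity)]
        apply rpow_le_one_of_one_le_of_nonpos _ (by linarith)
        rw [one_le_div hn0]; push_cast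
        have : (0:ℝ) ≤ i := by positivity
        linarith
      · rw [abs_of_nonneg (by positivity)]
        apply rpow_le_rpow_of_nonpos hs _ (by linarith)
        change s ≤ _ / L n
        rw [le_div_iff₀ hLn]
        have := Nat.lt_floor_add_one (L n * s)
        linarith
    · rw [hc, y_eq β₂ _ _ _ _ (hm0 n) (by positivity), abs_mul, abs_mul]
      rw [abs_of_pos hai]
      refine (mul_le_of_le_one_right (by positivity) ?_).trans
        (mul_le_mul_of_nonneg_right (hwC _ _) hai.le)
      rw [abs_of_nonneg (by positivity)]
      apply rpow_le_one_of_one_le_of_nonpos _ (by linarith)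
      rw [one_le_div hmn]; push_cast
      have : (0:ℝ) ≤ (⌊L n * s⌋₊ : ℝ) := by positivity
      linarith
  have hTmeas : ∀ n i, Measurable (fun s : ℝ => T n i ⌊L n * s⌋₊) := fun n i => by
    have h1 : Measurable (T n i) := measurable_from_nat
    exact h1.comp (Nat.measurable_floor.comp (measurable_const_mul _))
  have hTint : ∀ n : ℕ, 1 ≤ n → ∀ i, IntegrableOn (fun s : ℝ => T n i ⌊L n * s⌋₊) (Ioi 0) := by
    intro n hn i
    refine Integrable.mono' (hbint i) (hTmeas n i).aestronglyMeasurable ?_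
    refine (ae_restrict_mem measurableSet_Ioi).mono fun s hs => ?_
    exact hTb n hn i s hs
  have hkey : ∀ n : ℕ, 1 ≤ n →
      ρ n (m n) / ((n : ℝ) ^ (-(β₁ / β₂)) * (m n : ℝ) ^ (1 - β₂ * α)) =
      ∑' i, ∫ s in Ioi (0:ℝ), T n i ⌊L n * s⌋₊ := by
    intro n hn
    have hLn := hL0 n hn
    have hmn := hm0 n
    have hq : 0 < ((m n : ℝ) ^ β₂) ^ α := by positivity
    rw [hρ n (m n) hn (hm n), D_eq α β₁ β₂ _ _ hmn, ← tsum_div_const]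
    congr 1
    ext i
    have h1 := step_int' (T n i) (L n) hLn (hTint n hn i)
    have h2 : ∑' j, T n i j = ((m n : ℝ) ^ β₂) ^ α * ∑' j, V α (c (i + n) j) (c i (j + m n)) := by
      rw [← tsum_mul_left]
      congr 1
      ext j
      exact V_hom α _ _ _ (by positivity)
    rw [h2] at h1
    change _ / (L n * _) = _
    field_simp
    linarith
  have hev : ∀ᶠ n : ℕ in atTop, 1 ≤ n := eventually_ge_atTop 1
  have hncast : Tendsto (fun n : ℕ => (n : ℝ)) atTop atTop := tendsto_natCast_atTop_atTop
  have hLm : Tendsto (fun n : ℕ => L n / m n) atTop (nhds 0) := by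
    have h := (tendsto_rpow_neg_atTop (y := β₁ / β₂) (by positivity)).comp hncast
    refine h.congr fun n => ?_
    have := hm0 n
    simp only [hL, Function.comp]
    field_simp
  have hLtop : Tendsto L atTop atTop := by
    have h1 : Tendsto (fun n : ℕ => (m n : ℝ) ^ (-β₂) / (n : ℝ) ^ (-β₁)) atTop (nhdsWithin 0 (Ioi 0)) := by
      refine tendsto_nhdsWithin_iff.2 ⟨hratio, ?_⟩
      filter_upwards [hev] with n hn
      have hn0 : (0:ℝ) < n := by exact_mod_cast hn
      have := hm0 n
      simp only [mem_Ioi]; positivity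
    have h2 := (tendsto_rpow_atTop (y := 1 / β₂) (by positivity)).comp h1.inv_tendsto_nhdsGT_zero
    refine h2.congr' ?_
    filter_upwards [hev] with n hn
    have hn0 : (0:ℝ) < n := by exact_mod_cast hn
    have hmn := hm0 n
    have hLn := hL0 n hn
    have h3 : (m n : ℝ) ^ (-β₂) / (n : ℝ) ^ (-β₁) = (L n) ^ (-β₂) := by
      simp only [hL]
      rw [L_pow β₁ β₂ _ _ hmn hn0 hβ0, rpow_neg hn0.le]
      field_simp
    simp only [Function.comp, Pi.inv_apply]
    rw [h3, rpow_neg hLn.le, inv_inv, ← rpow_mul hLn.le, mul_one_div_cancel hβ0.ne', rpow_one]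
  have hlim : ∀ i, ∀ s : ℝ, 0 < s → Tendsto (fun n => T n i ⌊L n * s⌋₊) atTop
      (nhds (V α (s ^ (-β₂)) (winf i * a i))) := by
    intro i s hs
    have hjtop : Tendsto (fun n => ⌊L n * s⌋₊) atTop atTop :=
      tendsto_nat_floor_atTop.comp (hLtop.atTop_mul_const hs)
    have hjL : Tendsto (fun n => (1 + (⌊L n * s⌋₊ : ℝ)) / L n) atTop (nhds s) := by
      have h1 := (tendsto_nat_floor_mul_div_atTop (R := ℝ) hs.le).comp hLtop
      have h2 := hLtop.inv_tendsto_atTop.add h1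
      rw [zero_add] at h2
      refine h2.congr fun n => ?_
      simp only [Function.comp, Pi.inv_apply]
      rw [add_div, mul_comm s, one_div]
    apply V_tendsto
    · positivity
    · have h1 : Tendsto (fun n : ℕ => w (i + n) ⌊L n * s⌋₊) atTop (nhds 1) :=
        hA1.comp ((tendsto_add_atTop_nat i |>.congr fun n => add_comm _ _).prodMk hjtop)
      have h2 : Tendsto (fun n : ℕ => (1 + ((i + n : ℕ) : ℝ)) / n) atTop (nhds 1) := by
        have h3 := (hncast.inv_tendsto_atTop.const_mul (1 + (i:ℝ))).add_const 1
        rw [mul_zero, zero_add] at h3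
        refine h3.congr' ?_
        filter_upwards [hev] with n hn
        have hn0 : (0:ℝ) < n := by exact_mod_cast hn
        simp only [Pi.inv_apply]
        push_cast
        field_simp
        ring
      have h4 := (h1.mul (h2.rpow_const (p := -β₁) (Or.inl one_ne_zero))).mul
        (hjL.rpow_const (p := -β₂) (Or.inl hs.ne'))
      rw [one_rpow, one_mul, one_mul] at h4
      refine h4.congr' ?_
      filter_upwards [hev] with n hn
      have hn0 : (0:ℝ) < n := by exact_mod_cast hn
      rw [hc, x_eq β₁ β₂ _ n _ _ _ (hm0 n) hn0 (by positivity) (by positivity) hβ0]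
    · have h1 : Tendsto (fun n : ℕ => w i (⌊L n * s⌋₊ + m n)) atTop (nhds (winf i)) :=
        (hA2 i).1.comp (tendsto_atTop_mono (fun n => Nat.le_add_right _ _) hjtop)
      have h2 : Tendsto (fun n : ℕ => (1 + ((⌊L n * s⌋₊ + m n : ℕ) : ℝ)) / m n) atTop (nhds 1) := by
        have h3 := (hjL.mul hLm).add_const 1
        rw [mul_zero, zero_add] at h3
        refine h3.congr' ?_
        filter_upwards [hev] with n hn
        have := hL0 n hn
        have := hm0 n
        push_cast
        field_simp
        ring
      have h4 := (h1.mul_const (a i)).mul (h2.rpow_const (p := -β₂) (Or.inl one_ne_zero))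
      rw [one_rpow, mul_one] at h4
      refine h4.congr fun n => ?_
      rw [hc, y_eq β₂ _ _ _ _ (hm0 n) (by positivity)]
  have hmain : Tendsto (fun n : ℕ => ∑' i, ∫ s in Ioi (0:ℝ), T n i ⌊L n * s⌋₊) atTop
      (nhds (∑' i, ∫ s in Ioi (0 : ℝ), V α (s ^ (-β₂)) (winf i * a i))) := by
    apply tendsto_tsum_of_dominated_convergence (bound := fun i => ∫ s in Ioi (0:ℝ), b i s)
    · refine (bsum α β₁ β₂ C (∫ t in Ioi (0:ℝ), FF α β₂ t) hα hC hβ₁ hβ₂l).congr fun i => ?_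
      have : 0 < (a i) ^ (1 / β₂) := by have := ha0 i; positivity
      simp only [hb]
      rw [integral_const_mul, integral_comp_mul_right_Ioi _ _ this, zero_mul, smul_eq_mul]
    · intro i
      apply tendsto_integral_filter_of_dominated_convergence (b i)
      · exact Eventually.of_forall fun n => (hTmeas n i).aestronglyMeasurable
      · filter_upwards [hev] with n hn
        exact (ae_restrict_mem measurableSet_Ioi).mono fun s hs => hTb n hn i s hs
      · exact hbint i
      · exact (ae_restrict_mem measurableSet_Ioi).mono fun s hs => hlim i s hs
    · filter_upwards [hev] with n hn i
      apply norm_integral_le_of_norm_le (hbint i)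
      exact (ae_restrict_mem measurableSet_Ioi).mono fun s hs => hTb n hn i s hs
  have hfin : (∑' i : ℕ, ∫ s in Ioi (0 : ℝ), V α (winf i * a i) (s ^ (-β₂))) =
      ∑' i, ∫ s in Ioi (0 : ℝ), V α (s ^ (-β₂)) (winf i * a i) := by
    simp only [V_comm α (winf _ * a _)]
  rw [hfin]
  refine hmain.congr' ?_
  filter_upwards [hev] with n hn
  exact (hkey n hn).symm
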